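/- Let G be a d-regular simple graph (d > 0) on n vertices with adjacency matrix A and Â = (1/d)·A, and let β ≥ 0 satisfy ‖Â·x‖₂ ≤ β·‖x‖₂ for every x ∈ ℝⁿ with Σᵢ xᵢ = 0. For α ∈ [0,1], let M = α·Â + (1−α)·(1/n)·𝟙𝟙ᵀ be the PageRank transition matrix. Then for every probability vector v ∈ ℝⁿ and every t ∈ ℕ, ‖Mᵗ·v − u‖₂ ≤ (αβ)ᵗ, where u = (1/n)·𝟙. -/

import Mathlib

open Matrix Finset

/-- A convex combination of a matrix `P` with unit row sums and the uniform averaging matrix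
sends a vector `w` of total mass one to `u + α P (w - u)`. -/
lemma pagerank_mulVec_sub_uniform {n : ℕ} {P : Matrix (Fin n) (Fin n) ℝ}
    (hrow : ∀ i, ∑ j, P i j = 1) (α : ℝ) {w : Fin n → ℝ} (hw : ∑ i, w i = 1) (i : Fin n) :
    ((α • P + (1 - α) • ((n : ℝ)⁻¹ • Matrix.of (fun _ _ : Fin n => (1 : ℝ)))) *ᵥ w) i - 1 / n =
      α * (P *ᵥ fun j => w j - 1 / n) i := by
  have hP : (P *ᵥ fun j => w j - 1 / n) i = (P *ᵥ w) i - 1 / n := by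
    simp only [mulVec, dotProduct, mul_sub, sum_sub_distrib, ← sum_mul, hrow, one_mul]
  have hJ : (Matrix.of (fun _ _ : Fin n => (1 : ℝ)) *ᵥ w) i = 1 := by
    simp [mulVec, dotProduct, hw]
  rw [hP, add_mulVec, smul_mulVec, smul_mulVec, smul_mulVec]
  simp only [Pi.add_apply, Pi.smul_apply, smul_eq_mul, hJ]
  ring

/-- A matrix with unit column sums preserves the total mass of a vector. -/
lemma sum_mulVec_of_sum_col_eq_one {ι : Type*} [Fintype ι] {P : Matrix ι ι ℝ}
    (hcol : ∀ j, ∑ i, P i j = 1) (w : ι → ℝ) : ∑ i, (P *ᵥ w) i = ∑ i, w i := by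
  simp only [mulVec, dotProduct]
  rw [sum_comm]
  simp only [← sum_mul, hcol, one_mul]

lemma sum_sub_uniform {n : ℕ} {w : Fin n → ℝ} (hn : n ≠ 0) (hw : ∑ i, w i = 1) :
    ∑ i, (w i - 1 / n) = 0 := by
  have : (n : ℝ) ≠ 0 := Nat.cast_ne_zero.mpr hn
  simp [sum_sub_distrib, hw, this]

/-- A probability vector is at Euclidean distance at most one from the uniform vector. -/
lemma sum_sub_uniform_sq_le_one {n : ℕ} {v : Fin n → ℝ} (hn : n ≠ 0) (hv : ∀ i, 0 ≤ v i)
    (hsum : ∑ i, v i = 1) : ∑ i, (v i - 1 / n) ^ 2 ≤ 1 := by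
  have hn' : (n : ℝ) ≠ 0 := Nat.cast_ne_zero.mpr hn
  have hsq : ∑ i, v i ^ 2 ≤ 1 := by
    simpa [hsum] using sum_sq_le_sq_sum_of_nonneg fun i (_ : i ∈ univ) => hv i
  have hexpand : ∑ i, (v i - 1 / n) ^ 2 = ∑ i, v i ^ 2 - 1 / n := by
    simp only [sub_sq, sum_add_distrib, sum_sub_distrib, ← sum_mul, ← mul_sum, hsum, sum_const,
      card_univ, Fintype.card_fin, nsmul_eq_mul]
    field_simp
    ring
  have : (0 : ℝ) ≤ 1 / n := by positivity
  linarith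

lemma sum_row_inv_smul_adjMatrix {V : Type*} [Fintype V] {d : ℕ} (hd : 0 < d)
    {G : SimpleGraph V} [DecidableRel G.Adj] (hreg : G.IsRegularOfDegree d) (i : V) :
    ∑ j, ((d : ℝ)⁻¹ • G.adjMatrix ℝ) i j = 1 := by
  have hdeg : ∑ j, G.adjMatrix ℝ i j = d := by
    simpa [mulVec, dotProduct] using SimpleGraph.adjMatrix_mulVec_const_apply_of_regular
      (α := ℝ) (a := 1) hreg (v := i)
  have : (d : ℝ) ≠ 0 := Nat.cast_ne_zero.mpr hd.ne'
  simp only [Matrix.smul_apply, smul_eq_mul, ← mul_sum, hdeg]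
  exact inv_mul_cancel₀ this

/-- **Rapid mixing of PageRank on an expander.**
If `G` is `d`-regular with `Â = (1/d) A` contracting zero-sum vectors by `β` in ℓ², and
`M = α Â + (1-α) (1/n) 𝟙𝟙ᵀ` is the PageRank transition matrix for `α ∈ [0,1]`, then for
every probability vector `v` and every `t`, `‖Mᵗ v − u‖₂ ≤ (αβ)ᵗ`. -/
theorem pagerank_mixing_l2
    {n : ℕ} (d : ℕ) (hd : 0 < d) (G : SimpleGraph (Fin n)) [DecidableRel G.Adj]
    (hreg : G.IsRegularOfDegree d)
    (β : ℝ) (hβ : 0 ≤ β)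
    (hgap : ∀ x : Fin n → ℝ, ∑ i, x i = 0 →
      Real.sqrt (∑ i, ((((d : ℝ)⁻¹ • G.adjMatrix ℝ)).mulVec x i) ^ 2)
        ≤ β * Real.sqrt (∑ i, (x i) ^ 2))
    (α : ℝ) (hα : α ∈ Set.Icc (0 : ℝ) 1)
    (M : Matrix (Fin n) (Fin n) ℝ)
    (hM : M = α • ((d : ℝ)⁻¹ • G.adjMatrix ℝ)
        + (1 - α) • ((n : ℝ)⁻¹ • Matrix.of (fun _ _ : Fin n => (1 : ℝ)))) :
    ∀ (v : Fin n → ℝ), (∀ i, 0 ≤ v i) → ∑ i, v i = 1 →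
      ∀ t : ℕ,
        Real.sqrt (∑ i, ((M ^ t).mulVec v i - 1 / n) ^ 2) ≤ (α * β) ^ t := by
  intro v hv hsum t
  have hn : n ≠ 0 := by
    rintro rfl
    simp at hsum
  set P := (d : ℝ)⁻¹ • G.adjMatrix ℝ with hP
  have hrow : ∀ i, ∑ j, P i j = 1 := sum_row_inv_smul_adjMatrix hd hreg
  have hsymm : P.IsSymm := G.isSymm_adjMatrix.smul _
  have hcol : ∀ j, ∑ i, P i j = 1 := fun j => by
    rw [← hrow j]
    exact sum_congr rfl fun i _ => hsymm.apply j i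
  have hstep : ∀ {w : Fin n → ℝ}, ∑ i, w i = 1 → ∀ i,
      (M *ᵥ w) i - 1 / n = α * (P *ᵥ fun j => w j - 1 / n) i := fun hw i => by
    rw [hM]
    exact pagerank_mulVec_sub_uniform hrow α hw i
  have hmass : ∀ t, ∑ i, ((M ^ t) *ᵥ v) i = 1 := fun t => by
    induction t with
    | zero => simpa using hsum
    | succ t ih =>
      have hzero : ∑ i, ((M *ᵥ ((M ^ t) *ᵥ v)) i - 1 / n) = 0 := by
        simp only [hstep ih]
        rw [← mul_sum, sum_mulVec_of_sum_col_eq_one hcol, sum_sub_uniform hn ih, mul_zero]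
      have hn' : (n : ℝ) ≠ 0 := Nat.cast_ne_zero.mpr hn
      rw [pow_succ', ← mulVec_mulVec]
      simpa [sum_sub_distrib, hn', sub_eq_zero] using hzero
  induction t with
  | zero => simpa using sum_sub_uniform_sq_le_one hn hv hsum
  | succ t ih =>
    rw [pow_succ', ← mulVec_mulVec]
    simp only [hstep (hmass t), mul_pow α, ← mul_sum]
    rw [Real.sqrt_mul (sq_nonneg α), Real.sqrt_sq hα.1]
    calc α * √(∑ i, (P *ᵥ fun j => ((M ^ t) *ᵥ v) j - 1 / n) i ^ 2)
        ≤ α * (β * √(∑ i, (((M ^ t) *ᵥ v) i - 1 / n) ^ 2)) :=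
          mul_le_mul_of_nonneg_left (hgap _ (sum_sub_uniform hn (hmass t))) hα.1
      _ ≤ α * (β * (α * β) ^ t) := by
          have := hα.1
          gcongr
      _ = α ^ (t + 1) * β ^ (t + 1) := by ring
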